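/- For the conjugation action of S³ = SU(2) on itself, every S³-invariant 1-form ω on S³ is exact: there exists an invariant smooth function f with ω = df; in particular Ω¹(S³)^{S³} / d C^∞(S³)^{S³} = 0. -/

import Mathlib

set_option autoImplicit false

open scoped Quaternion

theorem hasDerivAt_integral_mul_comp_mul {w k : ℝ → ℝ} (hw : Continuous w)
    (hk : ContDiff ℝ 1 k) (t : ℝ) :
    HasDerivAt (fun t => ∫ s in (0 : ℝ)..1, w s * k (s * t))
      (∫ s in (0 : ℝ)..1, (w s * s) * deriv k (s * t)) t := by
  have hk' : Continuous (deriv k) := hk.continuous_deriv le_rfl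
  have hkc : Continuous k := hk.continuous
  obtain ⟨C, hC⟩ := ((isCompact_Icc (a := (0 : ℝ)) (b := 1)).prod
    (isCompact_closedBall t 1)).exists_bound_of_continuousOn
      (f := fun p : ℝ × ℝ => (w p.1 * p.1) * deriv k (p.1 * p.2)) (by fun_prop)
  refine (intervalIntegral.hasDerivAt_integral_of_dominated_loc_of_deriv_le
    (F := fun t s => w s * k (s * t)) (F' := fun t s => (w s * s) * deriv k (s * t))
    (bound := fun _ => C) (Metric.closedBall_mem_nhds t one_pos) ?_ ?_ ?_ ?_ ?_ ?_).2
  · exact .of_forall fun y => Continuous.aestronglyMeasurable (by fun_prop)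
  · exact Continuous.intervalIntegrable (by fun_prop) _ _
  · exact Continuous.aestronglyMeasurable (by fun_prop)
  · refine .of_forall fun s hs y hy => hC (s, y) ⟨?_, hy⟩
    rw [Set.uIoc_of_le zero_le_one] at hs
    exact Set.Ioc_subset_Icc_self hs
  · exact intervalIntegrable_const
  · refine .of_forall fun s _ y _ => ?_
    have h1 : HasDerivAt k (deriv k (s * y)) (s * y) :=
      (hk.differentiable one_ne_zero _).hasDerivAt
    have h2 : HasDerivAt (fun y => s * y) s y := by
      simpa using (hasDerivAt_id y).const_mul s
    refine ((h1.comp y h2).const_mul (w s)).congr_deriv ?_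
    ring

theorem contDiff_integral_mul_comp_mul (n : ℕ) {w k : ℝ → ℝ} (hw : Continuous w)
    (hk : ContDiff ℝ (⊤ : ℕ∞) k) :
    ContDiff ℝ n (fun t => ∫ s in (0 : ℝ)..1, w s * k (s * t)) := by
  induction n generalizing w k with
  | zero =>
    have hkc : Continuous k := hk.continuous
    exact contDiff_zero.2
      (intervalIntegral.continuous_parametric_intervalIntegral_of_continuous' (by fun_prop) _ _)
  | succ n ih =>
    have hd := hasDerivAt_integral_mul_comp_mul hw (hk.of_le (by exact_mod_cast le_top))
    push_cast
    refine contDiff_succ_iff_deriv.2 ⟨fun t => (hd t).differentiableAt, by simp, ?_⟩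
    rw [funext fun t => (hd t).deriv]
    exact ih (by fun_prop) (contDiff_infty_iff_deriv.1 hk).2

/-- The derivative of an even smooth function is `t` times an even smooth function. -/
theorem exists_deriv_eq_mul_of_even {g : ℝ → ℝ} (hg : ContDiff ℝ (⊤ : ℕ∞) g)
    (heven : ∀ t, g (-t) = g t) :
    ∃ g₁ : ℝ → ℝ, ContDiff ℝ (⊤ : ℕ∞) g₁ ∧ (∀ t, g₁ (-t) = g₁ t) ∧
      ∀ t, deriv g t = t * g₁ t := by
  have hg' := (contDiff_infty_iff_deriv.1 hg).2
  have hg'' := (contDiff_infty_iff_deriv.1 hg').2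
  have hodd : ∀ t, deriv g (-t) = -deriv g t := fun t => by
    have h := deriv_comp_neg g t
    rw [funext heven] at h
    linarith
  have heven' : ∀ t, deriv (deriv g) (-t) = deriv (deriv g) t := fun t => by
    have h := deriv_comp_neg (deriv g) t
    rw [funext hodd, deriv.fun_neg] at h
    linarith
  refine ⟨fun t => ∫ s in (0 : ℝ)..1, 1 * deriv (deriv g) (s * t), ?_, ?_, ?_⟩
  · exact contDiff_infty.2 fun n => contDiff_integral_mul_comp_mul n continuous_const hg''
  · intro t
    simp only [mul_neg, heven']
  · intro t
    have h0 : deriv g 0 = 0 := by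
      have := hodd 0
      rw [neg_zero] at this
      linarith
    have h := intervalIntegral.mul_integral_comp_mul_right (f := deriv (deriv g))
      (a := 0) (b := 1) t
    simp only [one_mul, zero_mul] at h ⊢
    rw [h, intervalIntegral.integral_deriv_eq_sub, h0, sub_zero]
    · exact fun x _ => (hg'.differentiable (by simp)) x
    · exact hg''.continuous.intervalIntegrable _ _

theorem hasFDerivAt_comp_norm {E : Type*} [NormedAddCommGroup E] [InnerProductSpace ℝ E]
    {g g₁ : ℝ → ℝ} (hg : Differentiable ℝ g) (h : ∀ t, deriv g t = t * g₁ t) (x : E) :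
    HasFDerivAt (fun x => g ‖x‖) (g₁ ‖x‖ • innerSL ℝ x) x := by
  rcases eq_or_ne x 0 with rfl | hx
  · have h0 : HasDerivAt g 0 0 := by
      have := (hg 0).hasDerivAt
      rwa [h, zero_mul] at this
    rw [hasDerivAt_iff_isLittleO_nhds_zero] at h0
    rw [hasFDerivAt_iff_isLittleO_nhds_zero]
    have := h0.comp_tendsto (tendsto_norm_zero (E := E))
    refine (this.norm_right.congr_left ?_).trans_eventuallyEq ?_ |>.of_norm_right
    · intro y; simp
    · exact .of_forall fun y => by simp
  · have hn : ‖x‖ ≠ 0 := norm_ne_zero_iff.2 hx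
    have h1 : HasFDerivAt (fun x : E => ‖x‖) (‖x‖⁻¹ • innerSL ℝ x) x := by
      have := (hasStrictFDerivAt_norm_sq x).hasFDerivAt.sqrt (by positivity)
      simp only [Real.sqrt_sq (norm_nonneg _)] at this
      convert this using 1
      ext v
      simp
      field_simp
    refine ((hg _).hasDerivAt.comp_hasFDerivAt x h1).congr_fderiv ?_
    rw [h, smul_smul]
    congr 1
    field_simp

/-- An even smooth function of the norm is smooth. -/
theorem contDiff_comp_norm_of_even {E : Type*} [NormedAddCommGroup E] [InnerProductSpace ℝ E]
    {g : ℝ → ℝ} (hg : ContDiff ℝ (⊤ : ℕ∞) g) (heven : ∀ t, g (-t) = g t) :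
    ContDiff ℝ (⊤ : ℕ∞) (fun x : E => g ‖x‖) := by
  refine contDiff_infty.2 fun n => ?_
  induction n generalizing g with
  | zero => exact contDiff_zero.2 (hg.continuous.comp continuous_norm)
  | succ n ih =>
    obtain ⟨g₁, hs, he, hd⟩ := exists_deriv_eq_mul_of_even hg heven
    exact contDiff_succ_iff_hasFDerivAt.2 ⟨_, (ih hs he).smul (innerSL ℝ).contDiff,
      hasFDerivAt_comp_norm (hg.differentiable (by simp)) hd⟩

theorem even_of_deriv_odd {F : ℝ → ℝ} (hF : Differentiable ℝ F)
    (hodd : ∀ t, deriv F (-t) = -deriv F t) (t : ℝ) : F (-t) = F t := by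
  have hd : ∀ s, HasDerivAt (fun s => F (-s) - F s) 0 s := fun s => by
    have h := ((hF (-s)).hasDerivAt.scomp s (hasDerivAt_neg s)).sub (hF s).hasDerivAt
    refine h.congr_deriv ?_
    simp [hodd]
  have h := is_const_of_deriv_eq_zero (fun s => (hd s).differentiableAt)
    (fun s => (hd s).deriv) t 0
  simp only [neg_zero, sub_self] at h
  linarith

theorem exists_contDiff_primitive {h : ℝ → ℝ} (hh : ContDiff ℝ (⊤ : ℕ∞) h) :
    ∃ F : ℝ → ℝ, ContDiff ℝ (⊤ : ℕ∞) F ∧ ∀ t, HasDerivAt F (h t) t := by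
  have hd : ∀ t, HasDerivAt (fun t => ∫ s in (0 : ℝ)..t, h s) (h t) t := fun t =>
    hh.continuous.integral_hasStrictDerivAt 0 t |>.hasDerivAt
  refine ⟨_, contDiff_infty_iff_deriv.2 ⟨fun t => (hd t).differentiableAt, ?_⟩, hd⟩
  rwa [funext fun t => (hd t).deriv]

namespace Quaternion

theorem sq_re_add_sq_norm_im (x : ℍ[ℝ]) : x.re ^ 2 + ‖x.im‖ ^ 2 = ‖x‖ ^ 2 := by
  rw [pow_two ‖x.im‖, pow_two ‖x‖, ← normSq_eq_norm_mul_self, ← normSq_eq_norm_mul_self,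
    normSq_def', normSq_def']
  simp
  ring

theorem contDiff_re {n : WithTop ℕ∞} : ContDiff ℝ n (fun x : ℍ[ℝ] => x.re) :=
  (LinearMap.toContinuousLinearMap
    ({ toFun := fun x => x.re, map_add' := fun _ _ => rfl, map_smul' := fun _ _ => rfl } :
      ℍ[ℝ] →ₗ[ℝ] ℝ)).contDiff

theorem contDiff_im {n : WithTop ℕ∞} : ContDiff ℝ n (fun x : ℍ[ℝ] => x.im) := by
  have h : (fun x : ℍ[ℝ] => x.im) = fun x => x - x.re • (1 : ℍ[ℝ]) := by
    ext x <;> simp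
  rw [h]
  exact contDiff_id.sub (contDiff_re.smul contDiff_const)

theorem arccos_re_div_norm {x : ℍ[ℝ]} (hx : 0 < x.re) :
    Real.arccos (x.re / ‖x‖) = Real.arctan ‖x.re⁻¹ • x.im‖ := by
  rw [Real.arctan_eq_arccos (norm_nonneg _), norm_smul, norm_inv, Real.norm_of_nonneg hx.le]
  congr 1
  have h : 1 + (x.re⁻¹ * ‖x.im‖) ^ 2 = (‖x‖ / x.re) ^ 2 := by
    rw [div_pow, ← sq_re_add_sq_norm_im]
    field_simp
  rw [h, Real.sqrt_sq (by positivity), inv_div]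

theorem contDiffAt_comp_arctan_im {F : ℝ → ℝ} (hF : ContDiff ℝ (⊤ : ℕ∞) F)
    (heven : ∀ t, F (-t) = F t) {x : ℍ[ℝ]} (hx : x.re ≠ 0) :
    ContDiffAt ℝ (⊤ : ℕ∞) (fun x : ℍ[ℝ] => F (Real.arctan ‖x.re⁻¹ • x.im‖)) x := by
  have h := contDiff_comp_norm_of_even (E := ℍ[ℝ]) (g := fun t => F (Real.arctan t))
    (hF.comp Real.contDiff_arctan) (fun t => by rw [Real.arctan_neg, heven])
  exact h.contDiffAt.comp x ((contDiff_re.contDiffAt.inv hx).smul contDiff_im.contDiffAt)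

/-- A smooth function of the angle to the real axis, symmetric about `0` and `π`, is smooth away
from the origin. -/
theorem contDiffAt_comp_arccos {F : ℝ → ℝ} (hF : ContDiff ℝ (⊤ : ℕ∞) F)
    (heven : ∀ t, F (-t) = F t) (hevenπ : ∀ t, F (Real.pi - t) = F (Real.pi + t))
    {x : ℍ[ℝ]} (hx : x ≠ 0) :
    ContDiffAt ℝ (⊤ : ℕ∞) (fun x : ℍ[ℝ] => F (Real.arccos (x.re / ‖x‖))) x := by
  have hre : Continuous fun x : ℍ[ℝ] => x.re := continuous_re
  rcases lt_trichotomy x.re 0 with h | h | h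
  · have hev : ∀ t, F (Real.pi - -t) = F (Real.pi - t) := fun t => by
      rw [sub_neg_eq_add, hevenπ]
    refine (contDiffAt_comp_arctan_im (F := fun t => F (Real.pi - t)) (by fun_prop) hev
      h.ne).congr_of_eventuallyEq ?_
    filter_upwards [hre.continuousAt.eventually_lt_const h] with y hy
    have hy' : 0 < (-y).re := by simpa using hy
    have := arccos_re_div_norm hy'
    have hs : (-y).re⁻¹ • (-y).im = y.re⁻¹ • y.im := by ext <;> simp
    rw [hs, re_neg, norm_neg, neg_div, Real.arccos_neg] at this
    rw [← this, sub_sub_cancel]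
  · refine hF.contDiffAt.comp x ((Real.contDiffAt_arccos ?_ ?_).comp x
      (contDiff_re.contDiffAt.div (contDiffAt_norm ℝ hx) (norm_ne_zero_iff.2 hx))) <;> simp [h]
  · refine (contDiffAt_comp_arctan_im hF heven h.ne').congr_of_eventuallyEq ?_
    filter_upwards [hre.continuousAt.eventually_const_lt h] with y hy
    rw [arccos_re_div_norm hy]

theorem re_conj {g : ℍ[ℝ]} (hg : g ≠ 0) (x : ℍ[ℝ]) : (g * x * g⁻¹).re = x.re := by
  have h : ∀ a b : ℍ[ℝ], (a * b).re = (b * a).re := fun a b => by simp; ring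
  rw [h, ← mul_assoc, inv_mul_cancel₀ hg, one_mul]

theorem norm_conj {g : ℍ[ℝ]} (hg : g ≠ 0) (x : ℍ[ℝ]) : ‖g * x * g⁻¹‖ = ‖x‖ := by
  have := norm_ne_zero_iff.2 hg
  rw [norm_mul, norm_mul, norm_inv]
  field_simp

/-- The quaternion `a + b i + c j + d k`. -/
def ofCoords (a b c d : ℝ) : ℍ[ℝ] := ⟨a, b, c, d⟩

@[simp] theorem re_ofCoords (a b c d : ℝ) : (ofCoords a b c d).re = a := rfl

@[simp] theorem imI_ofCoords (a b c d : ℝ) : (ofCoords a b c d).imI = b := rfl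

@[simp] theorem imJ_ofCoords (a b c d : ℝ) : (ofCoords a b c d).imJ = c := rfl

@[simp] theorem imK_ofCoords (a b c d : ℝ) : (ofCoords a b c d).imK = d := rfl

/-- The great circle through `1` and `i`. -/
noncomputable def circleI (θ : ℝ) : ℍ[ℝ] := ofCoords (Real.cos θ) (Real.sin θ) 0 0

/-- The velocity of `circleI`. -/
noncomputable def circleI' (θ : ℝ) : ℍ[ℝ] := ofCoords (-Real.sin θ) (Real.cos θ) 0 0

theorem circleI_eq :
    circleI = fun θ => Real.cos θ • (1 : ℍ[ℝ]) + Real.sin θ • ofCoords 0 1 0 0 := by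
  funext θ
  ext <;> simp [circleI]

theorem circleI'_eq :
    circleI' = fun θ => -Real.sin θ • (1 : ℍ[ℝ]) + Real.cos θ • ofCoords 0 1 0 0 := by
  funext θ
  ext <;> simp [circleI']

theorem hasDerivAt_circleI (θ : ℝ) : HasDerivAt circleI (circleI' θ) θ := by
  rw [circleI_eq, circleI'_eq]
  exact ((Real.hasDerivAt_cos θ).smul_const _).add ((Real.hasDerivAt_sin θ).smul_const _)

theorem contDiff_circleI : ContDiff ℝ (⊤ : ℕ∞) circleI := by
  rw [circleI_eq]
  exact (Real.contDiff_cos.smul contDiff_const).add (Real.contDiff_sin.smul contDiff_const)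

theorem contDiff_circleI' : ContDiff ℝ (⊤ : ℕ∞) circleI' := by
  rw [circleI'_eq]
  exact (Real.contDiff_sin.neg.smul contDiff_const).add (Real.contDiff_cos.smul contDiff_const)

theorem norm_eq_one_iff_sq (x : ℍ[ℝ]) :
    ‖x‖ = 1 ↔ x.re ^ 2 + x.imI ^ 2 + x.imJ ^ 2 + x.imK ^ 2 = 1 := by
  rw [← normSq_def', normSq_eq_norm_mul_self, ← pow_two,
    pow_eq_one_iff_of_nonneg (norm_nonneg x) two_ne_zero]

theorem norm_circleI (θ : ℝ) : ‖circleI θ‖ = 1 := by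
  simp [norm_eq_one_iff_sq, circleI]

theorem inv_eq_star_of_norm_eq_one {g : ℍ[ℝ]} (hg : ‖g‖ = 1) : g⁻¹ = star g := by
  rw [inv_def, normSq_eq_norm_mul_self, hg]
  simp

/-- Every unit quaternion is conjugate to a point of the upper half of `circleI`. -/
theorem exists_conj_eq_circleI {x : ℍ[ℝ]} (hx : ‖x‖ = 1) :
    ∃ g : ℍ[ℝ], ‖g‖ = 1 ∧ g * x * g⁻¹ = circleI (Real.arccos x.re) := by
  have hx2 := (norm_eq_one_iff_sq x).1 hx
  set r := Real.sin (Real.arccos x.re) with hr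
  have hr0 : 0 ≤ r := Real.sin_nonneg_of_mem_Icc ⟨Real.arccos_nonneg _, Real.arccos_le_pi _⟩
  have hcos : Real.cos (Real.arccos x.re) = x.re := Real.cos_arccos (by nlinarith) (by nlinarith)
  have hr2 : r ^ 2 = x.imI ^ 2 + x.imJ ^ 2 + x.imK ^ 2 := by
    have := Real.sin_sq_add_cos_sq (Real.arccos x.re)
    rw [hcos] at this
    linarith
  have hc : circleI (Real.arccos x.re) = ofCoords x.re r 0 0 := by rw [circleI, hcos, hr]
  rw [hc]
  suffices ∃ g : ℍ[ℝ], g ≠ 0 ∧ g * x = ofCoords x.re r 0 0 * g by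
    obtain ⟨g, hg, h⟩ := this
    have hn : ‖g‖ ≠ 0 := norm_ne_zero_iff.2 hg
    refine ⟨‖g‖⁻¹ • g, by rw [norm_smul]; simp [hn], ?_⟩
    rw [mul_inv_eq_iff_eq_mul₀ (by simp [hg]), smul_mul_assoc, h, mul_smul_comm]
  by_cases h0 : ofCoords (r + x.imI) 0 x.imK (-x.imJ) = 0
  · obtain ⟨h1, h3, h4⟩ : r + x.imI = 0 ∧ x.imK = 0 ∧ x.imJ = 0 := by
      simpa [Quaternion.ext_iff] using h0
    refine ⟨ofCoords 0 0 1 0, fun h => by simpa using congrArg (·.imJ) h, ?_⟩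
    ext <;> simp <;> linarith
  · refine ⟨_, h0, ?_⟩
    ext <;> simp <;> nlinarith

theorem conj_unitJ (v : ℍ[ℝ]) :
    ofCoords 0 0 1 0 * v * (ofCoords 0 0 1 0)⁻¹ = ofCoords v.re (-v.imI) v.imJ (-v.imK) := by
  rw [inv_eq_star_of_norm_eq_one (by simp [norm_eq_one_iff_sq])]
  ext <;> simp

theorem conj_unitI (v : ℍ[ℝ]) :
    ofCoords 0 1 0 0 * v * (ofCoords 0 1 0 0)⁻¹ = ofCoords v.re v.imI (-v.imJ) (-v.imK) := by
  rw [inv_eq_star_of_norm_eq_one (by simp [norm_eq_one_iff_sq])]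
  ext <;> simp

/-- A conjugation-invariant 1-form on the unit quaternions is determined by its values on the
velocity of `circleI`. -/
theorem apply_eq_of_invariant {ω : ℍ[ℝ] → (ℍ[ℝ] →L[ℝ] ℝ)}
    (hinv : ∀ g x v : ℍ[ℝ], ‖g‖ = 1 → ‖x‖ = 1 → (star x * v).re = 0 →
      ω (g * x * g⁻¹) (g * v * g⁻¹) = ω x v)
    {θ : ℝ} {v : ℍ[ℝ]} (hv : (star (circleI θ) * v).re = 0) :
    ω (circleI θ) v =
      (Real.cos θ * v.imI - Real.sin θ * v.re) * ω (circleI θ) (circleI' θ) := by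
  have hv' : Real.cos θ * v.re + Real.sin θ * v.imI = 0 := by
    simpa [circleI] using hv
  have hsc := Real.sin_sq_add_cos_sq θ
  have h := hinv (ofCoords 0 1 0 0) (circleI θ) (ofCoords 0 0 v.imJ v.imK)
    (by simp [norm_eq_one_iff_sq]) (norm_circleI θ) (by simp [circleI])
  rw [conj_unitI, conj_unitI] at h
  have hneg : ofCoords 0 0 (-v.imJ) (-v.imK) = -ofCoords 0 0 v.imJ v.imK := by ext <;> simp
  have h0 : ω (circleI θ) (ofCoords 0 0 v.imJ v.imK) = 0 := by
    have hfix : ofCoords (circleI θ).re (circleI θ).imI (-(circleI θ).imJ) (-(circleI θ).imK)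
        = circleI θ := by ext <;> simp [circleI]
    simp only [imJ_ofCoords, imK_ofCoords, re_ofCoords, imI_ofCoords] at h
    rw [hfix, hneg, map_neg] at h
    linarith
  have hdec : v = (Real.cos θ * v.imI - Real.sin θ * v.re) • circleI' θ
      + ofCoords 0 0 v.imJ v.imK := by
    ext <;> simp [circleI']
    · linear_combination Real.cos θ * hv' - v.re * hsc
    · linear_combination Real.sin θ * hv' - v.imI * hsc
  conv_lhs => rw [hdec]
  rw [map_add, map_smul, h0, add_zero, smul_eq_mul]

theorem fderiv_conj {f : ℍ[ℝ] → ℝ} (hf : Differentiable ℝ f) {g : ℍ[ℝ]}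
    (h : ∀ x, f (g * x * g⁻¹) = f x) (x v : ℍ[ℝ]) :
    fderiv ℝ f (g * x * g⁻¹) (g * v * g⁻¹) = fderiv ℝ f x v := by
  let L : ℍ[ℝ] →L[ℝ] ℍ[ℝ] := ContinuousLinearMap.mulLeftRight ℝ ℍ[ℝ] g g⁻¹
  have hL : f ∘ L = f := funext h
  have := (hf (L x)).hasFDerivAt.comp x L.hasFDerivAt
  rw [hL] at this
  rw [this.fderiv]
  rfl

end Quaternion

open Quaternion

/-- Every `S³`-invariant 1-form on `S³` (conjugation action) is exact, with an
invariant primitive; in particular `Ω¹(S³)^{S³} / d C^∞(S³)^{S³} = 0`.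

Concrete model: `S³ ⊂ ℍ` is the set of unit quaternions acting on itself by
conjugation `x ↦ g x g⁻¹`.  A smooth 1-form on `S³` is modeled by a smooth ambient
family `ω : ℍ → (ℍ →L[ℝ] ℝ)` of linear functionals, whose values matter only at
points `x` with `‖x‖ = 1` and tangent vectors `v` (i.e. `re(x̄ v) = 0`).  Invariance
means `ω(g x g⁻¹)(g v g⁻¹) = ω(x)(v)` for all unit `g`.  The conclusion produces a
smooth invariant function `f` with `ω = df` on `S³`. -/
theorem invariant_one_form_on_S3_exact
    (ω : ℍ[ℝ] → (ℍ[ℝ] →L[ℝ] ℝ)) (hsmooth : ContDiff ℝ (⊤ : ℕ∞) ω)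
    (hinv : ∀ g x v : ℍ[ℝ], ‖g‖ = 1 → ‖x‖ = 1 → (star x * v).re = 0 →
      ω (g * x * g⁻¹) (g * v * g⁻¹) = ω x v) :
    ∃ f : ℍ[ℝ] → ℝ, ContDiff ℝ (⊤ : ℕ∞) f ∧
      (∀ g x : ℍ[ℝ], ‖g‖ = 1 → ‖x‖ = 1 → f (g * x * g⁻¹) = f x) ∧
      ∀ x v : ℍ[ℝ], ‖x‖ = 1 → (star x * v).re = 0 → ω x v = fderiv ℝ f x v := by
  obtain ⟨F, hF, hFd⟩ := exists_contDiff_primitive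
    ((hsmooth.comp contDiff_circleI).clm_apply contDiff_circleI')
  have hF' : Differentiable ℝ F := hF.differentiable (by simp)
  have hodd : ∀ θ, deriv F (-θ) = -deriv F θ := fun θ => by
    rw [(hFd _).deriv, (hFd _).deriv]
    have h := hinv (ofCoords 0 0 1 0) (circleI θ) (circleI' θ) (by simp [norm_eq_one_iff_sq])
      (norm_circleI θ) (by simp [circleI, circleI']; ring)
    have h1 : ofCoords 0 0 1 0 * circleI θ * (ofCoords 0 0 1 0)⁻¹ = circleI (-θ) := by
      rw [conj_unitJ]; simp [circleI]
    have h2 : ofCoords 0 0 1 0 * circleI' θ * (ofCoords 0 0 1 0)⁻¹ = -circleI' (-θ) := by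
      rw [conj_unitJ]; ext <;> simp [circleI']
    rw [h1, h2, map_neg] at h
    simp only [Function.comp_apply]
    linarith
  have hper : ∀ θ, deriv F (θ + 2 * Real.pi) = deriv F θ := fun θ => by
    rw [(hFd _).deriv, (hFd _).deriv]
    simp [circleI, circleI']
  have heven := even_of_deriv_odd hF' hodd
  have hevenπ : ∀ t, F (Real.pi - t) = F (Real.pi + t) := fun t => by
    refine even_of_deriv_odd (F := fun t => F (Real.pi + t)) (by fun_prop) (fun s => ?_) t
    rw [deriv_comp_const_add, deriv_comp_const_add, ← hodd, ← hper (-(Real.pi + s))]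
    congr 1
    ring
  let f : ℍ[ℝ] → ℝ := fun x =>
    Real.smoothTransition (2 * ‖x‖ ^ 2 - 1) * F (Real.arccos (x.re / ‖x‖))
  have hfs : ContDiff ℝ (⊤ : ℕ∞) f := contDiff_iff_contDiffAt.2 fun x => by
    rcases eq_or_ne x 0 with rfl | hx
    · refine (contDiffAt_const (c := (0 : ℝ))).congr_of_eventuallyEq ?_
      have hc : ContinuousAt (fun y : ℍ[ℝ] => 2 * ‖y‖ ^ 2 - 1) 0 := by fun_prop
      filter_upwards [hc.eventually_lt_const (by simp : _ < (0 : ℝ))] with y hy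
      simp [f, Real.smoothTransition.zero_of_nonpos hy.le]
    · exact (Real.smoothTransition.contDiff.contDiffAt.comp x
        ((contDiffAt_const.mul (contDiff_norm_sq ℝ).contDiffAt).sub contDiffAt_const)).mul
          (contDiffAt_comp_arccos hF heven hevenπ hx)
  have hf1 : ∀ x : ℍ[ℝ], ‖x‖ = 1 → f x = F (Real.arccos x.re) := fun x hx => by
    simp [f, hx, Real.smoothTransition.one_of_one_le (x := 2 - 1) (by norm_num)]
  have hfg : ∀ g x : ℍ[ℝ], ‖g‖ = 1 → f (g * x * g⁻¹) = f x := fun g x hg => by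
    have hg0 : g ≠ 0 := norm_ne_zero_iff.1 (by simp [hg])
    simp only [f, re_conj hg0, norm_conj hg0]
  have hdf : Differentiable ℝ f := hfs.differentiable (by simp)
  have hcircle : ∀ θ ∈ Set.Icc 0 Real.pi,
      ω (circleI θ) (circleI' θ) = fderiv ℝ f (circleI θ) (circleI' θ) := fun θ hθ => by
    have h1 := ((hdf (circleI θ)).hasFDerivAt.comp_hasDerivAt θ
      (hasDerivAt_circleI θ)).hasDerivWithinAt (s := Set.Icc 0 Real.pi)
    have hEq : Set.EqOn (f ∘ circleI) F (Set.Icc 0 Real.pi) := fun t ht => by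
      rw [Function.comp_apply, hf1 _ (norm_circleI t)]
      exact congrArg F (Real.arccos_cos ht.1 ht.2)
    exact (uniqueDiffOn_Icc Real.pi_pos θ hθ).eq_deriv _
      ((hFd θ).hasDerivWithinAt.congr hEq (hEq hθ)) h1
  refine ⟨f, hfs, fun g x hg _ => hfg g x hg, fun x v hx hv => ?_⟩
  obtain ⟨g, hg, hgx⟩ := exists_conj_eq_circleI hx
  have hg0 : g ≠ 0 := norm_ne_zero_iff.1 (by simp [hg])
  have hv' : (star (circleI (Real.arccos x.re)) * (g * v * g⁻¹)).re = 0 := by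
    have : star (g * x * g⁻¹) * (g * v * g⁻¹) = g * (star x * v) * g⁻¹ := by
      rw [← inv_eq_star_of_norm_eq_one (by rw [norm_conj hg0, hx]),
        ← inv_eq_star_of_norm_eq_one hx]
      simp only [mul_inv_rev, inv_inv, mul_assoc, inv_mul_cancel_left₀ hg0]
    rw [← hgx, this, re_conj hg0, hv]
  rw [← hinv g x v hg hx hv, ← fderiv_conj hdf (fun y => hfg g y hg) x v, hgx,
    apply_eq_of_invariant hinv hv', apply_eq_of_invariant (ω := fderiv ℝ f)
      (fun g x v hg _ _ => fderiv_conj hdf (fun y => hfg g y hg) x v) hv',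
    hcircle _ ⟨Real.arccos_nonneg _, Real.arccos_le_pi _⟩]
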